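/- arXiv:1002.0984 — 2 statements merged into one kernel-verified Lean document; each statement's English description precedes it below -/
import Mathlib

section
/- Let X : [0,∞) → ℝ³ be a continuous path, let v ∈ ℝ³ with v ≠ 0, and let C > 0 satisfy ‖X(t) − t·v‖ ≤ C(1 + √t) for all t ≥ 0. Let Σ be an open subset of the unit sphere S² ⊂ ℝ³ with v/‖v‖ ∈ Σ. Then there exists R₀ > 0 such that for every R ≥ R₀ the first exit time τ_R(X) is finite, ‖X(τ_R(X))‖ = R, and X(τ_R(X))/R ∈ Σ (i.e. the path first exits the ball of radius R through the spherical cap R·Σ). -/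
open Filter Topology

section AsymptoticVelocity

variable {E : Type*} [NormedAddCommGroup E] [NormedSpace ℝ E] {X : ℝ → E} {v : E}

/-- A path within `C * (1 + √t)` of the ray `t • v` has asymptotic velocity `v`. -/
lemma tendsto_inv_smul_of_norm_sub_smul_le_sqrt {C : ℝ}
    (hbound : ∀ t : ℝ, 0 ≤ t → ‖X t - t • v‖ ≤ C * (1 + Real.sqrt t)) :
    Tendsto (fun t : ℝ => t⁻¹ • X t) atTop (𝓝 v) := by
  rw [tendsto_iff_norm_sub_tendsto_zero]
  have hlim : Tendsto (fun t : ℝ => C * (t⁻¹ + (Real.sqrt t)⁻¹)) atTop (𝓝 0) := by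
    simpa using (tendsto_inv_atTop_zero.add
      (tendsto_inv_atTop_zero.comp Real.tendsto_sqrt_atTop)).const_mul C
  refine squeeze_zero' (Eventually.of_forall fun _ => norm_nonneg _) ?_ hlim
  filter_upwards [eventually_gt_atTop 0] with t ht
  calc ‖t⁻¹ • X t - v‖ = t⁻¹ * ‖X t - t • v‖ := by
        rw [← abs_of_pos (inv_pos.2 ht), ← Real.norm_eq_abs, ← norm_smul, smul_sub, Real.norm_eq_abs,
          abs_of_pos (inv_pos.2 ht), inv_smul_smul₀ ht.ne']
    _ ≤ t⁻¹ * (C * (1 + Real.sqrt t)) := by gcongr; exact hbound t ht.le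
    _ = C * (t⁻¹ + (Real.sqrt t)⁻¹) := by
        rw [← Real.sqrt_div_self]
        ring

/-- A path with nonzero asymptotic velocity leaves every ball. -/
lemma tendsto_norm_atTop_of_tendsto_inv_smul (hv : v ≠ 0)
    (hX : Tendsto (fun t : ℝ => t⁻¹ • X t) atTop (𝓝 v)) :
    Tendsto (fun t => ‖X t‖) atTop atTop := by
  refine (tendsto_id.atTop_mul_pos (norm_pos_iff.2 hv) hX.norm).congr' ?_
  filter_upwards [eventually_gt_atTop 0] with t ht
  rw [norm_smul, norm_inv, Real.norm_of_nonneg ht.le, id, mul_inv_cancel_left₀ ht.ne']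

/-- The direction of a path with nonzero asymptotic velocity `v` tends to that of `v`. -/
lemma tendsto_normalize_of_tendsto_inv_smul (hv : v ≠ 0)
    (hX : Tendsto (fun t : ℝ => t⁻¹ • X t) atTop (𝓝 v)) :
    Tendsto (fun t => ‖X t‖⁻¹ • X t) atTop (𝓝 (‖v‖⁻¹ • v)) := by
  refine ((hX.norm.inv₀ (norm_ne_zero_iff.2 hv)).smul hX).congr' ?_
  filter_upwards [eventually_gt_atTop 0] with t ht
  rw [norm_smul, norm_inv, Real.norm_of_nonneg ht.le, smul_smul, mul_inv, inv_inv,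
    mul_right_comm, mul_inv_cancel₀ ht.ne', one_mul]

end AsymptoticVelocity

/-- If a continuous path starts in the closed ball of radius `R` and ever reaches norm `R`,
then its first exit time from the ball is attained, at norm exactly `R`. -/
lemma sInf_exit_nonneg_and_norm_eq {E : Type*} [SeminormedAddCommGroup E] {X : ℝ → E}
    (hX : ContinuousOn X (Set.Ici 0)) {R : ℝ} (h0 : ‖X 0‖ ≤ R)
    (hne : {t : ℝ | 0 ≤ t ∧ R ≤ ‖X t‖}.Nonempty) :
    0 ≤ sInf {t : ℝ | 0 ≤ t ∧ R ≤ ‖X t‖} ∧ ‖X (sInf {t : ℝ | 0 ≤ t ∧ R ≤ ‖X t‖})‖ = R := by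
  set A := {t : ℝ | 0 ≤ t ∧ R ≤ ‖X t‖}
  have hbdd : BddBelow A := ⟨0, fun _ ht => ht.1⟩
  have hclosed : IsClosed A := hX.norm.preimage_isClosed_of_isClosed isClosed_Ici isClosed_Ici
  obtain ⟨hτ, hRτ⟩ : sInf A ∈ A := hclosed.csInf_mem hne hbdd
  obtain ⟨s, hs, hsR⟩ := intermediate_value_Icc hτ
    (hX.norm.mono Set.Icc_subset_Ici_self) ⟨h0, hRτ⟩
  have hsτ : s = sInf A := le_antisymm hs.2 (csInf_le hbdd ⟨hs.1, hsR.ge⟩)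
  exact ⟨hτ, hsτ ▸ hsR⟩


/- STATEMENT 0: A continuous path that is asymptotically straight with nonzero
asymptotic velocity `v` eventually (for all large radii `R`) exits the ball of
radius `R` at a finite first exit time, through the spherical cap `R • S`,
where `S` is an open subset of the unit sphere containing `v/‖v‖`.
The first exit time from the ball of radius `R` is
`τ_R = sInf {t | 0 ≤ t ∧ R ≤ ‖X t‖}`; its finiteness is expressed by the
nonemptiness of this set (the set is bounded below by `0`). -/
theorem first_exit_through_cap_of_asymptotically_straight
    (X : ℝ → EuclideanSpace ℝ (Fin 3))
    (hXcont : ContinuousOn X (Set.Ici (0 : ℝ)))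
    (v : EuclideanSpace ℝ (Fin 3)) (hv : v ≠ 0)
    (C : ℝ) (hC : 0 < C)
    (hbound : ∀ t : ℝ, 0 ≤ t → ‖X t - t • v‖ ≤ C * (1 + Real.sqrt t))
    (S : Set (EuclideanSpace ℝ (Fin 3)))
    (hSsub : S ⊆ Metric.sphere (0 : EuclideanSpace ℝ (Fin 3)) 1)
    (hSopen : ∃ U : Set (EuclideanSpace ℝ (Fin 3)),
      IsOpen U ∧ S = U ∩ Metric.sphere (0 : EuclideanSpace ℝ (Fin 3)) 1)
    (hvS : ‖v‖⁻¹ • v ∈ S) :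
    ∃ R₀ > (0 : ℝ), ∀ R ≥ R₀,
      {t : ℝ | 0 ≤ t ∧ R ≤ ‖X t‖}.Nonempty ∧
      ‖X (sInf {t : ℝ | 0 ≤ t ∧ R ≤ ‖X t‖})‖ = R ∧
      R⁻¹ • X (sInf {t : ℝ | 0 ≤ t ∧ R ≤ ‖X t‖}) ∈ S := by
  have hlim := tendsto_inv_smul_of_norm_sub_smul_le_sqrt hbound
  obtain ⟨U, hU, rfl⟩ := hSopen
  obtain ⟨T, hT⟩ := eventually_atTop.1
    ((tendsto_normalize_of_tendsto_inv_smul hv hlim).eventually (hU.mem_nhds hvS.1))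
  obtain ⟨M, hM⟩ := (isCompact_Icc (a := 0) (b := max T 0)).exists_bound_of_continuousOn
    (hXcont.mono Set.Icc_subset_Ici_self)
  have hM0 : ‖X 0‖ ≤ M := hM 0 ⟨le_rfl, le_max_right _ _⟩
  have hMpos : 0 ≤ M := (norm_nonneg _).trans hM0
  refine ⟨M + 1, by positivity, fun R hR => ?_⟩
  have hRpos : 0 < R := by linarith
  have hne : {t : ℝ | 0 ≤ t ∧ R ≤ ‖X t‖}.Nonempty :=
    ((eventually_ge_atTop 0).and
      ((tendsto_norm_atTop_of_tendsto_inv_smul hv hlim).eventually_ge_atTop R)).exists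
  obtain ⟨hτ, hτR⟩ := sInf_exit_nonneg_and_norm_eq hXcont (by linarith) hne
  refine ⟨hne, hτR, ?_, ?_⟩
  · have hTτ : T ≤ sInf {t : ℝ | 0 ≤ t ∧ R ≤ ‖X t‖} := by
      by_contra! hlt
      linarith [hM _ ⟨hτ, hlt.le.trans (le_max_left _ _)⟩]
    have hmem := hT _ hTτ
    rwa [hτR] at hmem
  · rw [mem_sphere_zero_iff_norm, norm_smul, hτR, norm_inv, Real.norm_of_nonneg hRpos.le,
      inv_mul_cancel₀ hRpos.ne']
end

section
/- There exists a constant C > 0 such that for every m ≥ 1, every Schwartz function φ : ℝ³ × ℝ^m → ℂ, and every x₁ ∈ ℝ³, one has ∫_{ℝ^m} |φ(x₁, z)|² dz ≤ C · ( max_{1 ≤ i, j ≤ 3} ‖∂_i ∂_j φ‖_{L²(ℝ^{3+m})} )^{3/2} · ‖φ‖_{L²(ℝ^{3+m})}^{1/2}, where ∂_i denotes the partial derivative with respect to the i-th coordinate of the first factor ℝ³. -/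
open MeasureTheory
open scoped SchwartzMap FourierTransform LineDeriv

theorem SchwartzMap.integrable_norm_sq {E F : Type*} [NormedAddCommGroup E] [NormedSpace ℝ E]
    [MeasurableSpace E] [BorelSpace E] [SecondCountableTopology E] [NormedAddCommGroup F]
    [NormedSpace ℝ F] (μ : Measure E) [μ.HasTemperateGrowth] (f : 𝓢(E, F)) :
    Integrable (fun x => ‖f x‖ ^ 2) μ :=
  (f.memLp 2 μ).integrable_norm_pow two_ne_zero

theorem SchwartzMap.norm_apply_le_integral_norm_fourier {V : Type*} [NormedAddCommGroup V]
    [InnerProductSpace ℝ V] [FiniteDimensional ℝ V] [MeasurableSpace V] [BorelSpace V]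
    (f : 𝓢(V, ℂ)) (x : V) : ‖f x‖ ≤ ∫ ξ, ‖𝓕 f ξ‖ := by
  have h : f x = 𝓕⁻ (𝓕 f) x := by simp
  rw [h, SchwartzMap.fourierInv_coe, Real.fourierInv_eq']
  refine (norm_integral_le_integral_norm _).trans_eq ?_
  simp [Complex.norm_exp]

theorem SchwartzMap.fourier_sub_smul_sum_lineDeriv {d : ℕ}
    (f : 𝓢(EuclideanSpace ℝ (Fin d), ℂ)) (c : ℝ) (ξ : EuclideanSpace ℝ (Fin d)) :
    𝓕 (f - c ^ 2 • ∑ i : Fin d, ∂_{EuclideanSpace.single i (1 : ℝ)}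
      (∂_{EuclideanSpace.single i (1 : ℝ)} f)) ξ =
      ((1 + ‖(2 * Real.pi * c) • ξ‖ ^ 2 : ℝ) : ℂ) * 𝓕 f ξ := by
  have key (i : Fin d) : 𝓕 (∂_{EuclideanSpace.single i (1 : ℝ)}
      (∂_{EuclideanSpace.single i (1 : ℝ)} f)) ξ =
      -((2 * Real.pi * ξ i : ℝ) : ℂ) ^ 2 * 𝓕 f ξ := by
    have ht : (inner ℝ · (EuclideanSpace.single i (1 : ℝ))).HasTemperateGrowth := by fun_prop
    simp only [SchwartzMap.fourier_lineDerivOp_eq, smul_apply,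
      SchwartzMap.smulLeftCLM_apply_apply ht]
    simp [EuclideanSpace.inner_single_right, ← mul_assoc]
    ring_nf
    simp
  have hlin : 𝓕 (f - c ^ 2 • ∑ i : Fin d, ∂_{EuclideanSpace.single i (1 : ℝ)}
      (∂_{EuclideanSpace.single i (1 : ℝ)} f)) = 𝓕 f - c ^ 2 • ∑ i : Fin d,
      𝓕 (∂_{EuclideanSpace.single i (1 : ℝ)} (∂_{EuclideanSpace.single i (1 : ℝ)} f)) := by
    simp only [sub_eq_add_neg, ← neg_smul, FourierTransform.fourier_add,
      FourierTransform.fourier_smul, FourierTransform.fourier_sum]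
  rw [hlin]
  simp only [sub_apply, smul_apply, sum_apply, key,
    norm_smul, mul_pow, EuclideanSpace.norm_sq_eq]
  rw [← Finset.sum_mul]
  simp [Finset.mul_sum, mul_pow, Finset.sum_mul, add_mul]
  congr 1
  ext
  ring

theorem integral_mul_sq_le {α : Type*} [MeasurableSpace α] {μ : Measure α} {f g : α → ℝ}
    (hf0 : 0 ≤ f) (hg0 : 0 ≤ g) (hf : MemLp f 2 μ) (hg : MemLp g 2 μ) :
    (∫ x, f x * g x ∂μ) ^ 2 ≤ (∫ x, f x ^ 2 ∂μ) * ∫ x, g x ^ 2 ∂μ := by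
  have h := integral_mul_le_Lp_mul_Lq_of_nonneg (μ := μ) Real.HolderConjugate.two_two
    (.of_forall hf0) (.of_forall hg0) (by simpa using hf) (by simpa using hg)
  have h0 : 0 ≤ ∫ x, f x * g x ∂μ := integral_nonneg fun x => mul_nonneg (hf0 x) (hg0 x)
  simp only [Real.rpow_two, ← Real.sqrt_eq_rpow] at h
  calc _ ≤ _ := pow_le_pow_left₀ h0 h 2
    _ = _ := by
      rw [mul_pow, Real.sq_sqrt (integral_nonneg fun _ => sq_nonneg _),
        Real.sq_sqrt (integral_nonneg fun _ => sq_nonneg _)]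

theorem integrable_inv_one_add_norm_sq_sq :
    Integrable (fun ξ : EuclideanSpace ℝ (Fin 3) => ((1 + ‖ξ‖ ^ 2)⁻¹) ^ 2) := by
  have h := integrable_rpow_neg_one_add_norm_sq (E := EuclideanSpace ℝ (Fin 3)) (μ := volume)
    (r := 4) (by norm_num)
  refine h.congr (.of_forall fun ξ => ?_)
  have : (0 : ℝ) ≤ 1 + ‖ξ‖ ^ 2 := by positivity
  norm_num [Real.rpow_neg this]

theorem SchwartzMap.norm_apply_sq_le_integral_fourier
    (f : 𝓢(EuclideanSpace ℝ (Fin 3), ℂ)) {c : ℝ} (hc : 0 < c) (x : EuclideanSpace ℝ (Fin 3)) :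
    ‖f x‖ ^ 2 ≤ ((c ^ 3)⁻¹ * ∫ ξ : EuclideanSpace ℝ (Fin 3), ((1 + ‖ξ‖ ^ 2)⁻¹) ^ 2) *
      ∫ y, ‖(f - c ^ 2 • ∑ i : Fin 3, ∂_{EuclideanSpace.single i (1 : ℝ)}
      (∂_{EuclideanSpace.single i (1 : ℝ)} f)) y‖ ^ 2 := by
  set h := f - c ^ 2 • ∑ i : Fin 3, ∂_{EuclideanSpace.single i (1 : ℝ)}
      (∂_{EuclideanSpace.single i (1 : ℝ)} f) with hh
  set a : ℝ := 2 * Real.pi * c with ha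
  have hca : c ≤ a := by nlinarith [Real.pi_gt_three]
  have ha0 : 0 < a := hc.trans_le hca
  set w : EuclideanSpace ℝ (Fin 3) → ℝ := fun ξ => (1 + ‖a • ξ‖ ^ 2)⁻¹ with hw
  have hF (ξ) : ‖𝓕 f ξ‖ = w ξ * ‖𝓕 h ξ‖ := by
    have hpos : 0 < 1 + ‖a • ξ‖ ^ 2 := by positivity
    rw [hh, fourier_sub_smul_sum_lineDeriv, norm_mul, Complex.norm_real, Real.norm_of_nonneg hpos.le,
      ← mul_assoc, inv_mul_cancel₀ hpos.ne', one_mul]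
  have hwi : MemLp w 2 := by
    rw [memLp_two_iff_integrable_sq]
    · exact integrable_inv_one_add_norm_sq_sq.comp_smul ha0.ne'
    · refine Continuous.aestronglyMeasurable ?_
      exact Continuous.inv₀ (by fun_prop) fun ξ => by positivity
  have hw2 : ∫ ξ, w ξ ^ 2 =
      (a ^ 3)⁻¹ * ∫ ξ : EuclideanSpace ℝ (Fin 3), ((1 + ‖ξ‖ ^ 2)⁻¹) ^ 2 := by
    have := Measure.integral_comp_smul_of_nonneg (volume : Measure (EuclideanSpace ℝ (Fin 3)))
      (fun ξ => ((1 + ‖ξ‖ ^ 2)⁻¹) ^ 2) a (hR := ha0.le)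
    simpa [hw] using this
  calc ‖f x‖ ^ 2 ≤ (∫ ξ, w ξ * ‖𝓕 h ξ‖) ^ 2 := by
        simp only [← hF]
        gcongr
        exact norm_apply_le_integral_norm_fourier f x
    _ ≤ (∫ ξ, w ξ ^ 2) * ∫ ξ, ‖𝓕 h ξ‖ ^ 2 :=
        integral_mul_sq_le (fun ξ => by positivity) (fun ξ => norm_nonneg _) hwi
          ((𝓕 h).memLp 2).norm
    _ ≤ _ := by
        rw [integral_norm_sq_fourier, hw2]
        have : 0 ≤ ∫ ξ : EuclideanSpace ℝ (Fin 3), ((1 + ‖ξ‖ ^ 2)⁻¹) ^ 2 :=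
          integral_nonneg fun _ => by positivity
        gcongr

theorem norm_sub_smul_sum_sq_le {F : Type*} [SeminormedAddCommGroup F] [NormedSpace ℝ F] {d : ℕ}
    (u : F) (v : Fin d → F) (t : ℝ) :
    ‖u - t • ∑ i, v i‖ ^ 2 ≤ 2 * (‖u‖ ^ 2 + t ^ 2 * (d * ∑ i, ‖v i‖ ^ 2)) := by
  have h1 : ‖u - t • ∑ i, v i‖ ≤ ‖u‖ + |t| * ∑ i, ‖v i‖ := by
    refine (norm_sub_le _ _).trans ?_
    rw [norm_smul, Real.norm_eq_abs]
    gcongr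
    exact norm_sum_le _ _
  have h2 : (∑ i, ‖v i‖) ^ 2 ≤ d * ∑ i, ‖v i‖ ^ 2 := by
    simpa using sq_sum_le_card_mul_sum_sq (s := Finset.univ) (f := fun i => ‖v i‖)
  calc _ ≤ (‖u‖ + |t| * ∑ i, ‖v i‖) ^ 2 := by gcongr
    _ ≤ 2 * (‖u‖ ^ 2 + (|t| * ∑ i, ‖v i‖) ^ 2) := add_sq_le
    _ ≤ _ := by rw [mul_pow, sq_abs]; gcongr

theorem SchwartzMap.norm_apply_sq_le
    (f : 𝓢(EuclideanSpace ℝ (Fin 3), ℂ)) {c : ℝ} (hc : 0 < c) (x : EuclideanSpace ℝ (Fin 3)) :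
    ‖f x‖ ^ 2 ≤ ((c ^ 3)⁻¹ * ∫ ξ : EuclideanSpace ℝ (Fin 3), ((1 + ‖ξ‖ ^ 2)⁻¹) ^ 2) *
      (2 * ((∫ y, ‖f y‖ ^ 2) + c ^ 4 * (3 * ∑ i : Fin 3, ∫ y, ‖∂_{EuclideanSpace.single i (1 : ℝ)}
      (∂_{EuclideanSpace.single i (1 : ℝ)} f) y‖ ^ 2))) := by
  have h0 : 0 ≤ ∫ ξ : EuclideanSpace ℝ (Fin 3), ((1 + ‖ξ‖ ^ 2)⁻¹) ^ 2 :=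
    integral_nonneg fun _ => by positivity
  refine (f.norm_apply_sq_le_integral_fourier hc x).trans ?_
  gcongr
  have hi (g : 𝓢(EuclideanSpace ℝ (Fin 3), ℂ)) : Integrable fun y => ‖g y‖ ^ 2 :=
    g.integrable_norm_sq volume
  have hs : Integrable fun y => ∑ i : Fin 3, ‖∂_{EuclideanSpace.single i (1 : ℝ)}
      (∂_{EuclideanSpace.single i (1 : ℝ)} f) y‖ ^ 2 :=
    integrable_finsetSum _ fun i _ => hi _
  rw [← integral_finsetSum _ fun i _ => hi _, ← integral_const_mul, ← integral_const_mul,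
    ← integral_add (hi f) ((hs.const_mul _).const_mul _), ← integral_const_mul]
  refine integral_mono (hi _) (((hi f).add ((hs.const_mul _).const_mul _)).const_mul _) fun y => ?_
  have h := norm_sub_smul_sum_sq_le (f y) (fun i : Fin 3 =>
    (∂_{EuclideanSpace.single i (1 : ℝ)} (∂_{EuclideanSpace.single i (1 : ℝ)} f) :
      𝓢(EuclideanSpace ℝ (Fin 3), ℂ)) y) (c ^ 2)
  rw [← pow_mul] at h
  simpa only [sub_apply, smul_apply, sum_apply, Nat.cast_ofNat, Nat.reduceMul] using h

/-- Restriction of a Schwartz function on a product to the slice `E × {z}`. -/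
noncomputable def SchwartzMap.sliceLeft {E E' F : Type*} [NormedAddCommGroup E] [NormedSpace ℝ E]
    [NormedAddCommGroup E'] [NormedSpace ℝ E'] [NormedAddCommGroup F] [NormedSpace ℝ F]
    (φ : 𝓢(E × E', F)) (z : E') : 𝓢(E, F) :=
  compCLMOfAntilipschitz ℝ (K := 1) (g := fun x => (x, z)) (by
      have : (fun x : E => (x, z)) = fun x => ContinuousLinearMap.inl ℝ E E' x + (0, z) := by
        ext <;> simp
      rw [this]
      fun_prop)
    (AntilipschitzWith.of_le_mul_dist fun x y => by simp [Prod.dist_eq]) φ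

@[simp]
theorem SchwartzMap.sliceLeft_apply {E E' F : Type*} [NormedAddCommGroup E] [NormedSpace ℝ E]
    [NormedAddCommGroup E'] [NormedSpace ℝ E'] [NormedAddCommGroup F] [NormedSpace ℝ F]
    (φ : 𝓢(E × E', F)) (z : E') (x : E) : φ.sliceLeft z x = φ (x, z) := rfl

theorem SchwartzMap.lineDeriv_sliceLeft {E E' F : Type*} [NormedAddCommGroup E] [NormedSpace ℝ E]
    [NormedAddCommGroup E'] [NormedSpace ℝ E'] [NormedAddCommGroup F] [NormedSpace ℝ F]
    (φ : 𝓢(E × E', F)) (z : E') (e : E) :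
    ∂_{e} (φ.sliceLeft z) = (∂_{(e, (0 : E'))} φ).sliceLeft z := by
  ext x
  rw [sliceLeft_apply, lineDerivOp_apply, lineDerivOp_apply]
  simp [lineDeriv]

/-- Minimising `A / c ^ 3 + B * c` over `c > 0`. -/
theorem le_of_forall_pos_le_inv_pow_three_mul_add {L A B : ℝ} (hA : 0 ≤ A) (hB : 0 ≤ B)
    (h : ∀ c > 0, L ≤ (c ^ 3)⁻¹ * (A + c ^ 4 * B)) :
    L ≤ 2 * (B ^ ((3 : ℝ) / 4) * A ^ ((1 : ℝ) / 4)) := by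
  have h' (c : ℝ) (hc : 0 < c) : L ≤ (c ^ 3)⁻¹ * A + c * B := by
    refine (h c hc).trans_eq ?_
    field_simp
  have hlim : Filter.Tendsto (fun ε : ℝ => 2 * ((B + ε) ^ ((3 : ℝ) / 4) * (A + ε) ^ ((1 : ℝ) / 4)))
      (nhdsWithin 0 (Set.Ioi 0)) (nhds (2 * (B ^ ((3 : ℝ) / 4) * A ^ ((1 : ℝ) / 4)))) := by
    have : Continuous fun ε : ℝ => 2 * ((B + ε) ^ ((3 : ℝ) / 4) * (A + ε) ^ ((1 : ℝ) / 4)) := by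
      refine continuous_const.mul (.mul ?_ ?_) <;>
        exact (continuous_const.add continuous_id).rpow_const fun _ => Or.inr (by norm_num)
    simpa using (this.tendsto 0).mono_left nhdsWithin_le_nhds
  refine ge_of_tendsto hlim ?_
  filter_upwards [self_mem_nhdsWithin] with ε hε
  obtain ⟨hε, a0, b0⟩ : 0 < ε ∧ 0 < A + ε ∧ 0 < B + ε := by
    have : 0 < ε := hε
    exact ⟨this, by positivity, by positivity⟩
  set p := (A + ε) ^ ((1 : ℝ) / 4) with hp
  set q := (B + ε) ^ ((1 : ℝ) / 4) with hq
  have hp0 : 0 < p := by positivity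
  have hq0 : 0 < q := by positivity
  have hp4 : A + ε = p ^ 4 := by
    rw [hp, ← Real.rpow_natCast, ← Real.rpow_mul a0.le]; norm_num
  have hq4 : B + ε = q ^ 4 := by
    rw [hq, ← Real.rpow_natCast, ← Real.rpow_mul b0.le]; norm_num
  have hq3 : (B + ε) ^ ((3 : ℝ) / 4) = q ^ 3 := by
    rw [hq, ← Real.rpow_natCast, ← Real.rpow_mul b0.le]; norm_num
  have hc : 0 < p / q := by positivity
  calc L ≤ ((p / q) ^ 3)⁻¹ * A + p / q * B := h' _ hc
    _ ≤ ((p / q) ^ 3)⁻¹ * (A + ε) + p / q * (B + ε) := by gcongr <;> linarith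
    _ = 2 * ((B + ε) ^ ((3 : ℝ) / 4) * p) := by
      rw [hq3, hp4, hq4]
      field_simp
      ring

instance (m : ℕ) : (volume : Measure (EuclideanSpace ℝ (Fin 3) ×
    EuclideanSpace ℝ (Fin m))).HasTemperateGrowth :=
  Measure.IsAddHaarMeasure.instHasTemperateGrowth (h := Measure.prod.instIsAddHaarMeasure _ _)

theorem SchwartzMap.integrable_integral_norm_sq_slice {m : ℕ}
    (g : 𝓢(EuclideanSpace ℝ (Fin 3) × EuclideanSpace ℝ (Fin m), ℂ)) :
    Integrable fun z => ∫ x, ‖g (x, z)‖ ^ 2 :=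
  Integrable.integral_prod_right (μ := volume) (ν := volume) (g.integrable_norm_sq volume)

theorem SchwartzMap.integral_integral_norm_sq_slice {m : ℕ}
    (g : 𝓢(EuclideanSpace ℝ (Fin 3) × EuclideanSpace ℝ (Fin m), ℂ)) :
    ∫ z, ∫ x, ‖g (x, z)‖ ^ 2 = ∫ p, ‖g p‖ ^ 2 :=
  (integral_prod_symm (μ := volume) (ν := volume) _ (g.integrable_norm_sq volume)).symm

theorem SchwartzMap.integral_norm_sq_slice_le {m : ℕ}
    (φ : 𝓢(EuclideanSpace ℝ (Fin 3) × EuclideanSpace ℝ (Fin m), ℂ)) {c : ℝ} (hc : 0 < c)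
    (x : EuclideanSpace ℝ (Fin 3)) :
    ∫ z, ‖φ (x, z)‖ ^ 2 ≤
      ((c ^ 3)⁻¹ * ∫ ξ : EuclideanSpace ℝ (Fin 3), ((1 + ‖ξ‖ ^ 2)⁻¹) ^ 2) *
      (2 * ((∫ p, ‖φ p‖ ^ 2) + c ^ 4 * (3 * ∑ i : Fin 3,
        ∫ p, ‖∂_{(EuclideanSpace.single i (1 : ℝ), (0 : EuclideanSpace ℝ (Fin m)))}
          (∂_{(EuclideanSpace.single i (1 : ℝ), (0 : EuclideanSpace ℝ (Fin m)))} φ) p‖ ^ 2))) := by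
  have hs := integrable_finsetSum Finset.univ fun (i : Fin 3) _ =>
    (∂_{(EuclideanSpace.single i (1 : ℝ), (0 : EuclideanSpace ℝ (Fin m)))}
      (∂_{(EuclideanSpace.single i (1 : ℝ), (0 : EuclideanSpace ℝ (Fin m)))}
        φ)).integrable_integral_norm_sq_slice
  have hφ := φ.integrable_integral_norm_sq_slice
  have hx := fun z => (φ.sliceLeft z).norm_apply_sq_le hc x
  simp only [lineDeriv_sliceLeft, sliceLeft_apply] at hx
  generalize (∫ ξ : EuclideanSpace ℝ (Fin 3), ((1 + ‖ξ‖ ^ 2)⁻¹) ^ 2) = I at hx ⊢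
  simp only [← integral_integral_norm_sq_slice]
  rw [← integral_finsetSum _ fun i _ => integrable_integral_norm_sq_slice _,
    ← integral_const_mul, ← integral_const_mul, ← integral_add hφ ((hs.const_mul _).const_mul _),
    ← integral_const_mul, ← integral_const_mul]
  refine integral_mono_of_nonneg (.of_forall fun _ => by positivity)
    (((hφ.add ((hs.const_mul _).const_mul _)).const_mul _).const_mul _) (.of_forall hx)

/- STATEMENT 7: There is a universal constant `C > 0` such that for every
`m ≥ 1`, every Schwartz function `φ : ℝ³ × ℝ^m → ℂ` and every `x₁ ∈ ℝ³`,
`∫_{ℝ^m} |φ(x₁,z)|² dz ≤ C * (max_{i,j} ‖∂ᵢ∂ⱼφ‖_{L²})^{3/2} * ‖φ‖_{L²}^{1/2}`,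
where `∂ᵢ` is the partial derivative in the `i`-th coordinate of the first
factor `ℝ³` (realised as the directional derivative `fderiv` in direction
`(eᵢ, 0)`), the maximum over `1 ≤ i,j ≤ 3` is the supremum over `Fin 3 × Fin 3`,
and `‖f‖_{L²} = (∫ ‖f x‖²)^{1/2}`. -/
theorem slice_L2_bound_of_Gagliardo_Nirenberg :
    ∃ C > (0 : ℝ), ∀ m : ℕ, 1 ≤ m →
      ∀ (φ : SchwartzMap (EuclideanSpace ℝ (Fin 3) × EuclideanSpace ℝ (Fin m)) ℂ)
        (x₁ : EuclideanSpace ℝ (Fin 3)),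
        (∫ z : EuclideanSpace ℝ (Fin m), ‖φ (x₁, z)‖ ^ 2) ≤
          C *
            (⨆ i : Fin 3, ⨆ j : Fin 3,
              (∫ x : EuclideanSpace ℝ (Fin 3) × EuclideanSpace ℝ (Fin m),
                  ‖fderiv ℝ
                      (fun y => fderiv ℝ (fun w => φ w) y
                        (EuclideanSpace.single i (1 : ℝ), 0)) x
                    (EuclideanSpace.single j (1 : ℝ), 0)‖ ^ 2) ^ ((1 : ℝ) / 2))
              ^ ((3 : ℝ) / 2) *
            ((∫ x : EuclideanSpace ℝ (Fin 3) × EuclideanSpace ℝ (Fin m),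
                ‖φ x‖ ^ 2) ^ ((1 : ℝ) / 2)) ^ ((1 : ℝ) / 2) := by
  set I : ℝ := ∫ ξ : EuclideanSpace ℝ (Fin 3), ((1 + ‖ξ‖ ^ 2)⁻¹) ^ 2
  have hI : 0 ≤ I := integral_nonneg fun _ => by positivity
  refine ⟨2 * (18 * (I + 1)), by positivity, fun m _ φ x₁ => ?_⟩
  set M := ⨆ i : Fin 3, ⨆ j : Fin 3,
    (∫ x : EuclideanSpace ℝ (Fin 3) × EuclideanSpace ℝ (Fin m),
      ‖fderiv ℝ (fun y => fderiv ℝ (fun w => φ w) y (EuclideanSpace.single i (1 : ℝ), 0)) x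
        (EuclideanSpace.single j (1 : ℝ), 0)‖ ^ 2) ^ ((1 : ℝ) / 2) with hM
  set N := ∫ x : EuclideanSpace ℝ (Fin 3) × EuclideanSpace ℝ (Fin m), ‖φ x‖ ^ 2
  have hN0 : 0 ≤ N := integral_nonneg fun _ => by positivity
  have hM0 : 0 ≤ M := Real.iSup_nonneg fun i => Real.iSup_nonneg fun j => by positivity
  have hD (i : Fin 3) :
      ∫ p, ‖∂_{(EuclideanSpace.single i (1 : ℝ), (0 : EuclideanSpace ℝ (Fin m)))}
        (∂_{(EuclideanSpace.single i (1 : ℝ), (0 : EuclideanSpace ℝ (Fin m)))} φ) p‖ ^ 2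
        ≤ M ^ 2 := by
    rw [← Real.sqrt_le_left hM0, Real.sqrt_eq_rpow]
    exact le_ciSup_of_le (Set.finite_range _).bddAbove i
      (le_ciSup_of_le (Set.finite_range _).bddAbove i le_rfl)
  have key := le_of_forall_pos_le_inv_pow_three_mul_add (L := ∫ z, ‖φ (x₁, z)‖ ^ 2)
    (A := 18 * (I + 1) * N) (B := 18 * (I + 1) * M ^ 2) (by positivity) (by positivity)
    fun c hc => by
      calc _ ≤ _ := φ.integral_norm_sq_slice_le hc x₁
        _ ≤ ((c ^ 3)⁻¹ * I) * (2 * (N + c ^ 4 * (3 * ∑ i : Fin 3, M ^ 2))) := by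
          gcongr with i
          exact hD i
        _ = (c ^ 3)⁻¹ * (2 * I * N + c ^ 4 * (18 * I * M ^ 2)) := by
          simp
          ring
        _ ≤ _ := by
          gcongr <;> linarith
  refine key.trans_eq ?_
  rw [Real.mul_rpow (by positivity) (by positivity), Real.mul_rpow (by positivity) hN0,
    ← Real.rpow_natCast, ← Real.rpow_mul hM0, ← Real.rpow_mul hN0]
  have hK : (18 * (I + 1)) ^ ((3 : ℝ) / 4) * (18 * (I + 1)) ^ ((1 : ℝ) / 4) = 18 * (I + 1) := by
    rw [← Real.rpow_add (by positivity)]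
    norm_num
  norm_num
  linear_combination 2 * M ^ ((3 : ℝ) / 2) * N ^ ((1 : ℝ) / 4) * hK
end
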